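/- Let G be a finite simple graph and h : V(G) → ℕ a function with h(v) odd for all v. Then G has a spanning subgraph F with d_F(v) ∈ {1, 3, ..., h(v)} for every vertex v if and only if for every subset S of vertices, o(G − S) ≤ Σ_{v∈S} h(v). -/

import Mathlib

open SimpleGraph

/-- Number of odd-order components of `G - S`. -/
noncomputable def oddComp {V : Type*} [Fintype V] (G : SimpleGraph V) (S : Set V) : ℕ :=
  Nat.card {c : (G.induce Sᶜ).ConnectedComponent // Odd (Nat.card c.supp)}

/-- Degree of `v` in `F` (no decidability assumptions). -/
noncomputable def ndeg {V : Type*} (F : SimpleGraph V) (v : V) : ℕ :=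
  Nat.card (F.neighborSet v)

namespace SimpleGraph

variable {V : Type*}

/-- The blow-up of `G` in which each vertex `v` is replaced by a clique of size `h v`. -/
def cliqueBlowup (G : SimpleGraph V) (h : V → ℕ) : SimpleGraph (Σ v, Fin (h v)) where
  Adj x y := G.Adj x.1 y.1 ∨ (x.1 = y.1 ∧ x ≠ y)
  symm := ⟨fun _ _ hxy => hxy.imp (fun e => e.symm) fun e => ⟨e.1.symm, e.2.symm⟩⟩
  loopless := ⟨fun _ hx => hx.elim G.irrefl fun e => e.2 rfl⟩

/-- A finite graph with all degrees odd has an even number of vertices. -/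
lemma even_natCard_of_forall_odd_ndeg [Finite V] (F : SimpleGraph V)
    (hF : ∀ v, Odd (ndeg F v)) : Even (Nat.card V) := by
  classical
  cases nonempty_fintype V
  have key := F.even_card_odd_degree_vertices
  have hdeg : ∀ v, Odd (F.degree v) := fun v => by
    have := hF v
    rwa [ndeg, Nat.card_eq_fintype_card, card_neighborSet_eq_degree] at this
  simpa [hdeg, Nat.card_eq_fintype_card] using key

/-- If all degrees of `F ≤ G` are odd, every odd component of `G - S` is joined to `S` in `F`. -/
lemma exists_adj_of_odd_component [Finite V] {F G : SimpleGraph V} (hFG : F ≤ G)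
    (hF : ∀ v, Odd (ndeg F v)) {S : Set V} (c : (G.induce Sᶜ).ConnectedComponent)
    (hc : Odd (Nat.card c.supp)) : ∃ v : c.supp, ∃ w ∈ S, F.Adj w v.1 := by
  by_contra! hno
  refine Nat.not_even_iff_odd.mpr hc ?_
  refine even_natCard_of_forall_odd_ndeg (F.comap fun v : c.supp => (v.1 : V)) fun v => ?_
  convert hF v.1 using 1
  refine Nat.card_congr (Equiv.ofBijective (fun w => ⟨w.1.1, w.2⟩) ⟨?_, ?_⟩)
  · rintro ⟨w, _⟩ ⟨w', _⟩ e
    simpa [Subtype.ext_iff] using e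
  · rintro ⟨w, hw⟩
    have hwS : w ∈ Sᶜ := fun hwS => hno v w hwS hw.symm
    have hwc : (⟨w, hwS⟩ : (Sᶜ : Set V)) ∈ c.supp :=
      (c.mem_supp_congr_adj (show (G.induce Sᶜ).Adj v.1 ⟨w, hwS⟩ from hFG hw)).mp v.2
    exact ⟨⟨⟨⟨w, hwS⟩, hwc⟩, hw⟩, rfl⟩

lemma oddComp_le_sum_of_odd_factor [Fintype V] {F G : SimpleGraph V} (hFG : F ≤ G)
    (hF : ∀ v, Odd (ndeg F v)) (S : Finset V) : oddComp G (S : Set V) ≤ ∑ v ∈ S, ndeg F v := by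
  classical
  choose f g hg hgf using fun c : {c : (G.induce (S : Set V)ᶜ).ConnectedComponent //
    Odd (Nat.card c.supp)} => exists_adj_of_odd_component hFG hF c.1 c.2
  have hsum : ∑ v ∈ S, ndeg F v = Nat.card (Σ v : S, F.neighborSet v) := by
    rw [Nat.card_sigma, ← Finset.sum_coe_sort]
    rfl
  rw [hsum, oddComp]
  refine Nat.card_le_card_of_injective (fun c => ⟨⟨g c, hg c⟩, ⟨(f c).1, hgf c⟩⟩) ?_
  intro c d hcd
  have hval : ((f c).1 : V) = (f d).1 :=
    congrArg (fun x : Σ v : S, F.neighborSet v => (x.2 : V)) hcd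
  exact Subtype.ext (ConnectedComponent.eq_of_common_vertex (f c).2
    (Subtype.ext hval ▸ (f d).2))

/-- A perfect matching of the clique blow-up projects, modulo two, to an odd factor. -/
lemma exists_odd_factor_of_isPerfectMatching [Fintype V] {G : SimpleGraph V} {h : V → ℕ}
    (hodd : ∀ v, Odd (h v)) {M : (G.cliqueBlowup h).Subgraph} (hM : M.IsPerfectMatching) :
    ∃ F : SimpleGraph V, F ≤ G ∧ ∀ v, Odd (ndeg F v) ∧ ndeg F v ≤ h v := by
  classical
  choose p hp hpu using Subgraph.isPerfectMatching_iff.mp hM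
  have hpp : ∀ x, p (p x) = x := fun x => (hpu (p x) x (hp x).symm).symm
  have hpne : ∀ x, p x ≠ x := fun x e => (hp x).ne e.symm
  let B : V → V → Finset (Σ v, Fin (h v)) := fun v w => {x | x.1 = v ∧ (p x).1 = w}
  have hB : ∀ v w x, x ∈ B v w ↔ x.1 = v ∧ (p x).1 = w := by simp [B]
  have hBsymm : ∀ v w, (B v w).card = (B w v).card := fun v w =>
    Finset.card_bij' (fun x _ => p x) (fun x _ => p x)
      (by simp +contextual [hB, hpp]) (by simp +contextual [hB, hpp])
      (by simp [hpp]) (by simp [hpp])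
  have hBdiag : ∀ v, Even (B v v).card := fun v => by
    rw [← ZMod.natCast_eq_zero_iff_even, Finset.cast_card]
    refine Finset.sum_involution (fun x _ => p x) (fun _ _ => by decide)
      (fun x _ _ => hpne x) ?_ (fun x _ => hpp x)
    simp +contextual [hB, hpp]
  have hBsum : ∀ v, ∑ w, (B v w).card = h v := fun v => by
    have hfib := Finset.card_eq_sum_card_fiberwise
      (s := Finset.univ.filter fun x : Σ v, Fin (h v) => x.1 = v) (t := Finset.univ)
      (f := fun x => (p x).1) (fun _ _ => Finset.mem_coe.mpr (Finset.mem_univ _))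
    simp only [Finset.filter_filter] at hfib
    rw [← hfib]
    have : (Finset.univ.filter fun x : Σ v, Fin (h v) => x.1 = v) =
        (Finset.univ : Finset (Fin (h v))).map (Function.Embedding.sigmaMk v) := by
      ext ⟨w, i⟩
      constructor
      · simp only [Finset.mem_filter, Finset.mem_univ, true_and]
        rintro rfl
        simp
      · simp only [Finset.mem_map]
        rintro ⟨j, -, e⟩
        simp [← e]
    simp [this]
  let F : SimpleGraph V :=
    { Adj := fun v w => v ≠ w ∧ Odd (B v w).card
      symm := ⟨fun v w hvw => ⟨hvw.1.symm, hBsymm v w ▸ hvw.2⟩⟩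
      loopless := ⟨fun v hv => hv.1 rfl⟩ }
  refine ⟨F, ?_, fun v => ?_⟩
  · rintro v w ⟨hne, hvw⟩
    obtain ⟨x, hx⟩ := Finset.card_pos.mp hvw.pos
    obtain ⟨rfl, rfl⟩ := (hB _ _ _).mp hx
    exact (hp x).adj_sub.resolve_right fun e => hne e.1
  have hdeg : ndeg F v = ((Finset.univ.erase v).filter fun w => Odd (B v w).card).card := by
    rw [ndeg, Nat.card_coe_set_eq, ← Set.ncard_coe_finset]
    congr 1
    ext w
    simp [F, eq_comm]
  have hsplit : (B v v).card + ∑ w ∈ Finset.univ.erase v, (B v w).card = h v := by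
    rw [Finset.add_sum_erase _ (fun w => (B v w).card) (Finset.mem_univ v), hBsum]
  have hev := hBdiag v
  refine ⟨?_, ?_⟩
  · rw [hdeg, ← Finset.odd_sum_iff_odd_card_odd]
    have := hodd v
    rw [← hsplit] at this
    exact (Nat.odd_add'.mp this).mpr hev
  · rw [hdeg, ← hsplit, Finset.card_filter]
    refine (Finset.sum_le_sum fun w _ => ?_).trans (Nat.le_add_left _ _)
    split_ifs with hw
    exacts [hw.pos, Nat.zero_le _]

/-- The condition on `G` implies Tutte's condition on its clique blow-up. -/
lemma not_isTutteViolator_cliqueBlowup [Fintype V] {G : SimpleGraph V} {h : V → ℕ}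
    (hodd : ∀ v, Odd (h v))
    (hG : ∀ S : Finset V, oddComp G (S : Set V) ≤ ∑ v ∈ S, h v)
    (u : Set (Σ v, Fin (h v))) : ¬(G.cliqueBlowup h).IsTutteViolator u := by
  classical
  let S : Finset V := {v | ∀ i, (⟨v, i⟩ : Σ v, Fin (h v)) ∈ u}
  have hS : ∀ v, v ∈ S ↔ ∀ i, (⟨v, i⟩ : Σ v, Fin (h v)) ∈ u := by simp [S]
  set H := ((⊤ : (G.cliqueBlowup h).Subgraph).deleteVerts u) with hH
  have hmem : ∀ x, x ∈ H.verts ↔ x ∉ u := by simp [hH]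
  have hadj : ∀ x y : H.verts, H.coe.Adj x y ↔ (G.cliqueBlowup h).Adj x.1 y.1 := fun x y => by
    have hx := (hmem _).mp x.2
    have hy := (hmem _).mp y.2
    simp [hH, hx, hy]
  let π : H.verts → ((S : Set V)ᶜ : Set V) := fun x =>
    ⟨x.1.1, fun hx => (hmem _).mp x.2 ((hS _).mp hx x.1.2)⟩
  have hexists : ∀ v : ((S : Set V)ᶜ : Set V), ∃ i, (⟨v.1, i⟩ : Σ v, Fin (h v)) ∉ u := fun v => by
    have := v.2
    rw [Set.mem_compl_iff, Finset.mem_coe, hS] at this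
    exact not_forall.mp this
  choose s hs using hexists
  let σ : G.induce (S : Set V)ᶜ →g H.coe :=
    { toFun := fun v => ⟨⟨v.1, s v⟩, (hmem _).mpr (hs v)⟩
      map_rel' := fun {v w} hvw => (hadj _ _).mpr (Or.inl hvw) }
  have hσπ : ∀ x, H.coe.Reachable x (σ (π x)) := fun x => by
    by_cases e : x = σ (π x)
    · rw [← e]
    · exact ((hadj x (σ (π x))).mpr (Or.inr ⟨rfl, fun e' => e (Subtype.ext e')⟩)).reachable
  have hπ : ∀ x y, H.coe.Reachable x y → (G.induce (S : Set V)ᶜ).Reachable (π x) (π y) := by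
    rintro x y ⟨w⟩
    induction w with
    | nil => rfl
    | @cons a b c hab _ ih =>
      refine Reachable.trans ?_ ih
      rcases (hadj _ _).mp hab with hab | hab
      · exact Adj.reachable (show (G.induce (S : Set V)ᶜ).Adj (π a) (π b) from hab)
      · rw [show π a = π b from Subtype.ext hab.1]
  have hπ' : ∀ x y, (G.induce (S : Set V)ᶜ).Reachable (π x) (π y) → H.coe.Reachable x y :=
    fun x y hxy => ((hσπ x).trans (hxy.map σ)).trans (hσπ y).symm
  let g : H.coe.ConnectedComponent → (G.induce (S : Set V)ᶜ).ConnectedComponent := fun c =>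
    (G.induce (S : Set V)ᶜ).connectedComponentMk (π c.out)
  have hg : ∀ c x, x ∈ c.supp ↔ π x ∈ (g c).supp := fun c x => by
    have hout : H.coe.connectedComponentMk c.out = c := c.out_eq
    simp only [ConnectedComponent.mem_supp_iff, g, ConnectedComponent.eq]
    conv_lhs => rw [← hout, ConnectedComponent.eq]
    exact ⟨hπ _ _, hπ' _ _⟩
  have hginj : Function.Injective g := fun c d hcd => by
    have hc : c.out ∈ c.supp := c.out_eq
    exact ConnectedComponent.eq_of_common_vertex hc ((hg d _).mpr (hcd ▸ (hg c _).mp hc))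
  have hdef : ∀ c : H.coe.oddComponents, ¬Odd (Nat.card (g c).supp) →
      ∃ x : {x : Σ v, Fin (h v) // x ∈ u ∧ x.1 ∉ S}, ⟨x.1.1, x.2.2⟩ ∈ (g c).supp := by
    rintro ⟨c, hc⟩ heven
    by_contra! hno
    have hfull : ∀ v ∈ (g c).supp, ∀ i, (⟨v.1, i⟩ : Σ v, Fin (h v)) ∉ u := fun v hv i hi =>
      hno ⟨⟨v.1, i⟩, hi, v.2⟩ hv
    have hcard : c.supp.ncard = ∑ v : (g c).supp, h v.1 := by
      have hsig : Nat.card (Σ v : (g c).supp, Fin (h v.1)) = ∑ v : (g c).supp, h v.1 := by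
        simp
      rw [← hsig, ← Nat.card_coe_set_eq]
      refine Nat.card_congr
        { toFun := fun x => ⟨⟨π x.1, (hg c _).mp x.2⟩, x.1.1.2⟩
          invFun := fun y => ⟨⟨⟨y.1.1.1, y.2⟩, (hmem _).mpr (hfull _ y.1.2 _)⟩,
            (hg c _).mpr y.1.2⟩
          left_inv := fun _ => rfl
          right_inv := fun _ => rfl }
    have hc' : Odd c.supp.ncard := hc
    rw [hcard, Finset.odd_sum_iff_odd_card_odd] at hc'
    apply heven
    simpa [hodd, Nat.card_eq_fintype_card] using hc'
  choose d hd using hdef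
  let T := {c : (G.induce (S : Set V)ᶜ).ConnectedComponent // Odd (Nat.card c.supp)}
  let D := {x : Σ v, Fin (h v) // x ∈ u ∧ x.1 ∉ S}
  let φ : H.coe.oddComponents → T ⊕ D := fun c =>
    if hc : Odd (Nat.card (g c).supp) then Sum.inl ⟨g c, hc⟩ else Sum.inr (d c hc)
  have hφ : Function.Injective φ := by
    intro a b hab
    apply Subtype.ext
    apply hginj
    by_cases ha : Odd (Nat.card (g a).supp) <;> by_cases hb : Odd (Nat.card (g b).supp) <;>
      simp only [φ, ha, hb, dite_true, dite_false, Sum.inl.injEq, Sum.inr.injEq, reduceCtorEq] at hab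
    · exact congrArg Subtype.val hab
    · have h₁ := hd a ha
      rw [hab] at h₁
      exact ConnectedComponent.eq_of_common_vertex h₁ (hd b hb)
  have hle : Nat.card T + Nat.card D ≤ u.ncard := by
    have hSu : ∑ v ∈ S, h v = Nat.card {x : Σ v, Fin (h v) // x ∈ u ∧ x.1 ∈ S} := by
      have hsig : Nat.card (Σ v : S, Fin (h v.1)) = ∑ v ∈ S, h v := by
        simp [Finset.sum_attach S h]
      rw [← hsig]
      exact Nat.card_congr
        { toFun := fun y => ⟨⟨y.1.1, y.2⟩, (hS _).mp y.1.2 _, y.1.2⟩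
          invFun := fun x => ⟨⟨x.1.1, x.2.2⟩, x.1.2⟩
          left_inv := fun _ => rfl
          right_inv := fun _ => rfl }
    have hsplit : u.ncard = (∑ v ∈ S, h v) + Nat.card D := by
      rw [hSu, ← Set.ncard_inter_add_ncard_sdiff_eq_ncard u {x | x.1 ∈ S}]
      rfl
    rw [hsplit]
    exact Nat.add_le_add_right (hG S) _
  rw [IsTutteViolator, not_lt, ← Nat.card_coe_set_eq]
  exact (Nat.card_le_card_of_injective φ hφ).trans (Nat.card_sum.trans_le hle)

end SimpleGraph

/-- Cui–Kano: `G` has a `(1,h)`-odd factor iff `o(G-S) ≤ h(S)` for all `S`. -/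
theorem stmt_1 {V : Type*} [Fintype V] (G : SimpleGraph V) (h : V → ℕ)
    (hodd : ∀ v, Odd (h v)) :
    (∃ F : SimpleGraph V, F ≤ G ∧ ∀ v : V, Odd (ndeg F v) ∧ ndeg F v ≤ h v) ↔
      (∀ S : Finset V, oddComp G (↑S : Set V) ≤ ∑ v ∈ S, h v) := by
  refine ⟨fun ⟨F, hFG, hF⟩ S => ?_, fun hG => ?_⟩
  · exact (oddComp_le_sum_of_odd_factor hFG (fun v => (hF v).1) S).trans
      (Finset.sum_le_sum fun v _ => (hF v).2)
  · obtain ⟨M, hM⟩ := tutte.mpr (not_isTutteViolator_cliqueBlowup hodd hG)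
    exact exists_odd_factor_of_isPerfectMatching hodd hM
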